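/- Let f(x, W) = f̃(W₁x, W₂) with f̃ differentiable, let x₁, …, xₙ ∈ ℝ^d be nonzero training points, W* = (W₁*, W₂*) an interpolation solution with w parameters, and k ≥ 1. Assume: (i) for every parameter coordinate j, (1/n) Σᵢ (∂f/∂W_j(xᵢ, W*))^{2k} ≤ 2^k B^{k−1}/η^k (the consequence of k-th order linear stability of SGD with learning rate η and batch size B); (ii) f satisfies the (C, δ_approx, k)-local smoothness condition at each (xᵢ, W*); and (iii) δ ≤ δ_approx ‖xᵢ‖₂/‖W₁*‖₂ for every i. Then for every x in X_δ = ∪ᵢ B(xᵢ, δ): ‖∇_x f(x, W*)‖_{2k} ≤ (C ‖(W₁*)ᵀ‖_{2k} / minᵢ ‖xᵢ‖_{2k}) · ((2nw/B)^{1/(2k)} √(2B/η) + 1). -/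

import Mathlib

/-- Matrix–vector product of `W : ℝ^{m×d}` (as a function) with `x : ℝ^d`. -/
noncomputable def mVec {m d : ℕ} (W : Fin m → Fin d → ℝ) (x : Fin d → ℝ) : Fin m → ℝ :=
  fun r => ∑ s, W r s * x s

/-- Euclidean (ℓ²) norm of a vector in `ℝ^d`. -/
noncomputable def l2norm {d : ℕ} (v : Fin d → ℝ) : ℝ := Real.sqrt (∑ j, v j ^ 2)

/-- Operator norm of a matrix induced by Euclidean norms. -/
noncomputable def opNorm2 {m d : ℕ} (W : Fin m → Fin d → ℝ) : ℝ :=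
  sSup {r : ℝ | ∃ x : Fin d → ℝ, l2norm x = 1 ∧ r = l2norm (mVec W x)}

/-- ℓ^{2k} norm of a vector. -/
noncomputable def lpnorm (k : ℕ) {d : ℕ} (v : Fin d → ℝ) : ℝ :=
  (∑ j, |v j| ^ (2 * k)) ^ ((2 * k : ℝ))⁻¹

/-- Operator norm of a matrix induced by ℓ^{2k} norms on domain and codomain. -/
noncomputable def opNormP (k : ℕ) {m d : ℕ} (W : Fin m → Fin d → ℝ) : ℝ :=
  sSup {r : ℝ | ∃ x : Fin d → ℝ, lpnorm k x = 1 ∧ r = lpnorm k (mVec W x)}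

/-- Euclidean distance between two (flattened) parameter pairs `W = (W₁, W₂)`. -/
noncomputable def paramDist {m d p : ℕ}
    (W W' : (Fin m → Fin d → ℝ) × (Fin p → ℝ)) : ℝ :=
  Real.sqrt ((∑ r, ∑ s, (W.1 r s - W'.1 r s) ^ 2) + ∑ l, (W.2 l - W'.2 l) ^ 2)

/-- The ℓ^{2k} norm `‖∇_W F‖_{2k}` of the gradient of `F : (W₁, W₂) ↦ ℝ` with respect to all
(flattened) parameters. -/
noncomputable def gradWnorm {m d p : ℕ} (k : ℕ)
    (F : ((Fin m → Fin d → ℝ) × (Fin p → ℝ)) → ℝ)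
    (W : (Fin m → Fin d → ℝ) × (Fin p → ℝ)) : ℝ :=
  ((∑ r, ∑ s, |fderiv ℝ F W (Pi.single r (Pi.single s 1), 0)| ^ (2 * k))
    + ∑ l, |fderiv ℝ F W (0, Pi.single l 1)| ^ (2 * k)) ^ ((2 * k : ℝ))⁻¹

section PowerNorm

variable {k m d : ℕ}

lemma lpnorm_nonneg (v : Fin d → ℝ) : 0 ≤ lpnorm k v := by
  unfold lpnorm
  positivity

lemma rpow_two_mul_inv_pow (hk : 1 ≤ k) {a : ℝ} (ha : 0 ≤ a) :
    (a ^ ((2 * k : ℝ))⁻¹) ^ (2 * k) = a := by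
  have h := Real.rpow_inv_natCast_pow ha (n := 2 * k) (by omega)
  push_cast at h
  exact h

lemma pow_rpow_two_mul_inv (hk : 1 ≤ k) {a : ℝ} (ha : 0 ≤ a) :
    (a ^ (2 * k)) ^ ((2 * k : ℝ))⁻¹ = a := by
  have h := Real.pow_rpow_inv_natCast ha (n := 2 * k) (by omega)
  push_cast at h
  exact h

lemma lpnorm_pow (hk : 1 ≤ k) (v : Fin d → ℝ) :
    lpnorm k v ^ (2 * k) = ∑ j, |v j| ^ (2 * k) :=
  rpow_two_mul_inv_pow hk (by positivity)

lemma lpnorm_mono {v w : Fin d → ℝ} (h : ∀ j, |v j| ≤ |w j|) : lpnorm k v ≤ lpnorm k w := by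
  unfold lpnorm
  exact Real.rpow_le_rpow (by positivity)
    (Finset.sum_le_sum fun j _ => pow_le_pow_left₀ (abs_nonneg _) (h j) _) (by positivity)

lemma lpnorm_smul (hk : 1 ≤ k) (c : ℝ) (v : Fin d → ℝ) :
    lpnorm k (fun j => c * v j) = |c| * lpnorm k v := by
  unfold lpnorm
  simp_rw [abs_mul, mul_pow]
  rw [← Finset.mul_sum, Real.mul_rpow (by positivity) (by positivity),
    pow_rpow_two_mul_inv hk (abs_nonneg c)]

lemma abs_le_lpnorm (hk : 1 ≤ k) (v : Fin d → ℝ) (j : Fin d) : |v j| ≤ lpnorm k v := by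
  refine le_of_pow_le_pow_left₀ (n := 2 * k) (by omega) (lpnorm_nonneg v) ?_
  rw [lpnorm_pow hk]
  exact Finset.single_le_sum (f := fun j => |v j| ^ (2 * k)) (fun _ _ => by positivity)
    (Finset.mem_univ j)

lemma lpnorm_zero (hk : 1 ≤ k) : lpnorm k (0 : Fin d → ℝ) = 0 := by
  simpa [← Pi.zero_def] using lpnorm_smul hk 0 (0 : Fin d → ℝ)

lemma lpnorm_pos (hk : 1 ≤ k) {v : Fin d → ℝ} (hv : v ≠ 0) : 0 < lpnorm k v := by
  obtain ⟨j, hj⟩ := Function.ne_iff.mp hv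
  exact (abs_pos.mpr hj).trans_le (abs_le_lpnorm hk v j)

lemma mVec_smul (W : Fin m → Fin d → ℝ) (c : ℝ) (x : Fin d → ℝ) :
    mVec W (fun j => c * x j) = fun r => c * mVec W x r := by
  ext r
  simp only [mVec, Finset.mul_sum]
  exact Finset.sum_congr rfl fun _ _ => by ring

lemma bddAbove_opNormP (hk : 1 ≤ k) (W : Fin m → Fin d → ℝ) :
    BddAbove {r : ℝ | ∃ x : Fin d → ℝ, lpnorm k x = 1 ∧ r = lpnorm k (mVec W x)} := by
  refine ⟨lpnorm k fun r => ∑ s, |W r s|, ?_⟩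
  rintro _ ⟨x, hx, rfl⟩
  refine lpnorm_mono fun r => ?_
  rw [abs_of_nonneg (a := ∑ s, |W r s|) (by positivity)]
  refine (Finset.abs_sum_le_sum_abs _ _).trans (Finset.sum_le_sum fun s _ => ?_)
  rw [abs_mul]
  exact mul_le_of_le_one_right (abs_nonneg _) (hx ▸ abs_le_lpnorm hk x s)

lemma opNormP_nonneg (W : Fin m → Fin d → ℝ) : 0 ≤ opNormP k W := by
  refine Real.sSup_nonneg ?_
  rintro _ ⟨x, -, rfl⟩
  exact lpnorm_nonneg _

lemma lpnorm_mVec_le (hk : 1 ≤ k) (W : Fin m → Fin d → ℝ) (x : Fin d → ℝ) :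
    lpnorm k (mVec W x) ≤ opNormP k W * lpnorm k x := by
  rcases eq_or_ne x 0 with rfl | hx
  · have h0 : mVec W 0 = 0 := by ext r; simp [mVec]
    rw [h0, lpnorm_zero hk, lpnorm_zero hk, mul_zero]
  · have hpos := lpnorm_pos hk hx
    have h := le_csSup (bddAbove_opNormP hk W)
      ⟨fun j => (lpnorm k x)⁻¹ * x j, by
        rw [lpnorm_smul hk, abs_of_pos (inv_pos.mpr hpos), inv_mul_cancel₀ hpos.ne'], rfl⟩
    rw [mVec_smul, lpnorm_smul hk, abs_of_pos (inv_pos.mpr hpos), inv_mul_le_iff₀ hpos] at h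
    rwa [mul_comm]

lemma l2norm_eq_lpnorm (v : Fin d → ℝ) : l2norm v = lpnorm 1 v := by
  simp [l2norm, lpnorm, Real.sqrt_eq_rpow]

lemma l2norm_mVec_le (W : Fin m → Fin d → ℝ) (x : Fin d → ℝ) :
    l2norm (mVec W x) ≤ opNorm2 W * l2norm x := by
  have h : opNorm2 W = opNormP 1 W := by simp only [opNorm2, opNormP, l2norm_eq_lpnorm]
  rw [h, l2norm_eq_lpnorm, l2norm_eq_lpnorm]
  exact lpnorm_mVec_le le_rfl W x

lemma opNorm2_nonneg (W : Fin m → Fin d → ℝ) : 0 ≤ opNorm2 W := by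
  refine Real.sSup_nonneg ?_
  rintro _ ⟨x, -, rfl⟩
  exact Real.sqrt_nonneg _

lemma l2norm_sq (v : Fin d → ℝ) : l2norm v ^ 2 = ∑ j, v j ^ 2 :=
  Real.sq_sqrt (by positivity)

end PowerNorm

section FirstLayer

variable {m d p : ℕ}

/-- The weight perturbation sending `x` to `mVec W z`, of minimal Frobenius norm. -/
noncomputable def rankOneShift (W : Fin m → Fin d → ℝ) (x z : Fin d → ℝ) : Fin m → Fin d → ℝ :=
  fun r s => W r s + mVec W (fun t => z t - x t) r * x s / l2norm x ^ 2

lemma mVec_rankOneShift (W : Fin m → Fin d → ℝ) {x : Fin d → ℝ} (hx : 0 < l2norm x)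
    (z : Fin d → ℝ) : mVec (rankOneShift W x z) x = mVec W z := by
  ext r
  have h1 : ∀ a : ℝ, ∑ s, a * x s / l2norm x ^ 2 * x s = a := fun a => by
    calc ∑ s, a * x s / l2norm x ^ 2 * x s
        = a / l2norm x ^ 2 * ∑ s, x s ^ 2 := by
          rw [Finset.mul_sum]
          exact Finset.sum_congr rfl fun _ _ => by ring
      _ = a := by rw [← l2norm_sq]; field_simp
  simp only [mVec, rankOneShift, add_mul, Finset.sum_add_distrib] at h1 ⊢
  rw [h1, ← Finset.sum_add_distrib]
  exact Finset.sum_congr rfl fun _ _ => by ring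

lemma paramDist_rankOneShift (W : Fin m → Fin d → ℝ) (b : Fin p → ℝ) {x : Fin d → ℝ}
    (hx : 0 < l2norm x) (z : Fin d → ℝ) :
    paramDist (rankOneShift W x z, b) (W, b)
      = l2norm (mVec W fun t => z t - x t) / l2norm x := by
  set u := mVec W fun t => z t - x t with hu
  have h : ∑ r, ∑ s, (rankOneShift W x z r s - W r s) ^ 2 = (l2norm u / l2norm x) ^ 2 := by
    calc ∑ r, ∑ s, (rankOneShift W x z r s - W r s) ^ 2
        = ∑ r, u r ^ 2 * (∑ s, x s ^ 2) / l2norm x ^ 4 := by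
          refine Finset.sum_congr rfl fun r _ => ?_
          rw [Finset.mul_sum, Finset.sum_div]
          refine Finset.sum_congr rfl fun s _ => ?_
          simp only [rankOneShift, ← hu]
          ring
      _ = (l2norm u / l2norm x) ^ 2 := by
          rw [← Finset.sum_div, ← Finset.sum_mul, ← l2norm_sq, ← l2norm_sq]
          field_simp
  have hn : 0 ≤ l2norm u / l2norm x := div_nonneg (Real.sqrt_nonneg _) hx.le
  simp only [paramDist, h, sub_self]
  simp [Real.sqrt_sq hn]

lemma paramDist_rankOneShift_le (W : Fin m → Fin d → ℝ) (b : Fin p → ℝ) {x z : Fin d → ℝ}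
    (hx : 0 < l2norm x) {δ δa : ℝ} (hδa : 0 ≤ δa) (hz : l2norm (fun t => z t - x t) ≤ δ)
    (hδ : δ ≤ δa * l2norm x / opNorm2 W) :
    paramDist (rankOneShift W x z, b) (W, b) ≤ δa := by
  rw [paramDist_rankOneShift W b hx, div_le_iff₀ hx]
  refine (l2norm_mVec_le W _).trans ?_
  rcases (opNorm2_nonneg W).eq_or_lt with h0 | hpos
  · rw [← h0, zero_mul]
    positivity
  · rw [mul_comm, ← le_div_iff₀ hpos]
    exact hz.trans hδ

lemma mVec_single_single (x : Fin d → ℝ) (r : Fin m) (s : Fin d) :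
    mVec (Pi.single r (Pi.single s 1)) x = x s • (Pi.single r 1 : Fin m → ℝ) := by
  ext r'
  rcases eq_or_ne r' r with rfl | h
  · simp [mVec, Pi.single_apply]
  · simp [mVec, h]

lemma mVec_single (W : Fin m → Fin d → ℝ) (j : Fin d) :
    mVec W (Pi.single j 1) = ∑ r, W r j • (Pi.single r 1 : Fin m → ℝ) := by
  ext r
  simp [mVec, Pi.single_apply, Finset.sum_apply]

/-- `mVec W` as a continuous linear map in the input. -/
noncomputable def mVecInputCLM (W : Fin m → Fin d → ℝ) : (Fin d → ℝ) →L[ℝ] (Fin m → ℝ) :=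
  LinearMap.toContinuousLinearMap
    { toFun := mVec W
      map_add' := fun a b => by ext r; simp [mVec, mul_add, Finset.sum_add_distrib]
      map_smul' := fun c a => mVec_smul W c a }

/-- `fun W => mVec W x` as a continuous linear map in the weights. -/
noncomputable def mVecWeightCLM (x : Fin d → ℝ) : (Fin m → Fin d → ℝ) →L[ℝ] (Fin m → ℝ) :=
  LinearMap.toContinuousLinearMap
    { toFun := fun W => mVec W x
      map_add' := fun a b => by ext r; simp [mVec, add_mul, Finset.sum_add_distrib]
      map_smul' := fun c a => by ext r; simp [mVec, Finset.mul_sum, mul_assoc] }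

variable {ft : (Fin m → ℝ) → (Fin p → ℝ) → ℝ}

lemma fderiv_weight_apply
    (hft : Differentiable ℝ (fun q : (Fin m → ℝ) × (Fin p → ℝ) => ft q.1 q.2))
    (x : Fin d → ℝ) (V D : (Fin m → Fin d → ℝ) × (Fin p → ℝ)) :
    fderiv ℝ (fun V : (Fin m → Fin d → ℝ) × (Fin p → ℝ) => ft (mVec V.1 x) V.2) V D
      = fderiv ℝ (fun q : (Fin m → ℝ) × (Fin p → ℝ) => ft q.1 q.2)
          (mVec V.1 x, V.2) (mVec D.1 x, D.2) := by
  let L := (mVecWeightCLM (m := m) x).prodMap (ContinuousLinearMap.id ℝ (Fin p → ℝ))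
  have h := (hft (L V)).hasFDerivAt.comp V L.hasFDerivAt
  exact congrArg (fun T => T D) h.fderiv

lemma fderiv_input_apply
    (hft : Differentiable ℝ (fun q : (Fin m → ℝ) × (Fin p → ℝ) => ft q.1 q.2))
    (W : Fin m → Fin d → ℝ) (b : Fin p → ℝ) (z v : Fin d → ℝ) :
    fderiv ℝ (fun u => ft (mVec W u) b) z v
      = fderiv ℝ (fun q : (Fin m → ℝ) × (Fin p → ℝ) => ft q.1 q.2) (mVec W z, b) (mVec W v, 0) := by
  have h := (hft (mVec W z, b)).hasFDerivAt.comp z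
    ((mVecInputCLM W).hasFDerivAt.prodMk (hasFDerivAt_const b z))
  exact congrArg (fun T => T v) h.fderiv

/-- The gradient of `ft` in its first argument. -/
noncomputable def hiddenGrad (ft : (Fin m → ℝ) → (Fin p → ℝ) → ℝ) (h : Fin m → ℝ)
    (b : Fin p → ℝ) : Fin m → ℝ :=
  fun r => fderiv ℝ (fun q : (Fin m → ℝ) × (Fin p → ℝ) => ft q.1 q.2) (h, b) (Pi.single r 1, 0)

lemma fderiv_weight_single
    (hft : Differentiable ℝ (fun q : (Fin m → ℝ) × (Fin p → ℝ) => ft q.1 q.2))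
    (x : Fin d → ℝ) (V : (Fin m → Fin d → ℝ) × (Fin p → ℝ)) (r : Fin m) (s : Fin d) :
    fderiv ℝ (fun V : (Fin m → Fin d → ℝ) × (Fin p → ℝ) => ft (mVec V.1 x) V.2) V
        (Pi.single r (Pi.single s 1), 0)
      = hiddenGrad ft (mVec V.1 x) V.2 r * x s := by
  have h : ((x s • (Pi.single r 1 : Fin m → ℝ), (0 : Fin p → ℝ)) : (Fin m → ℝ) × (Fin p → ℝ))
      = x s • (Pi.single r 1, 0) := by simp
  rw [fderiv_weight_apply hft, mVec_single_single, h, map_smul, smul_eq_mul, mul_comm]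
  rfl

lemma fderiv_input_single
    (hft : Differentiable ℝ (fun q : (Fin m → ℝ) × (Fin p → ℝ) => ft q.1 q.2))
    (W : Fin m → Fin d → ℝ) (b : Fin p → ℝ) (z : Fin d → ℝ) :
    (fun j => fderiv ℝ (fun u => ft (mVec W u) b) z (Pi.single j 1))
      = mVec (fun s r => W r s) (hiddenGrad ft (mVec W z) b) := by
  ext j
  have h : (((∑ r, W r j • (Pi.single r 1 : Fin m → ℝ)), (0 : Fin p → ℝ)) :
      (Fin m → ℝ) × (Fin p → ℝ)) = ∑ r, W r j • (Pi.single r 1, 0) := by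
    ext <;> simp [Prod.fst_sum, Prod.snd_sum]
  rw [fderiv_input_apply hft, mVec_single, h, map_sum]
  simp only [map_smul, smul_eq_mul]
  rfl

lemma lpnorm_hiddenGrad_mul_le_gradWnorm
    (hft : Differentiable ℝ (fun q : (Fin m → ℝ) × (Fin p → ℝ) => ft q.1 q.2)) {k : ℕ}
    (hk : 1 ≤ k) (x : Fin d → ℝ) (V : (Fin m → Fin d → ℝ) × (Fin p → ℝ)) :
    lpnorm k (hiddenGrad ft (mVec V.1 x) V.2) * lpnorm k x
      ≤ gradWnorm k (fun V => ft (mVec V.1 x) V.2) V := by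
  unfold lpnorm gradWnorm
  rw [← Real.mul_rpow (by positivity) (by positivity)]
  simp only [fderiv_weight_single hft, abs_mul, mul_pow, ← Finset.mul_sum, ← Finset.sum_mul]
  gcongr
  exact le_add_of_nonneg_right (by positivity)

end FirstLayer

lemma pow_le_of_mean_pow_le {n k : ℕ} {M : ℝ} (g : Fin n → ℝ)
    (h : (1 / (n : ℝ)) * ∑ i, g i ^ (2 * k) ≤ M) (i : Fin n) : |g i| ^ (2 * k) ≤ n * M := by
  have hn : (0 : ℝ) < n := Nat.cast_pos.mpr i.pos
  rw [one_div, inv_mul_le_iff₀ hn] at h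
  refine le_trans ?_ h
  rw [(even_two_mul k).pow_abs]
  exact Finset.single_le_sum (f := fun i => g i ^ (2 * k))
    (fun _ _ => (even_two_mul k).pow_nonneg _) (Finset.mem_univ i)

lemma gradWnorm_le_of_pow_le {m d p k : ℕ} {F : ((Fin m → Fin d → ℝ) × (Fin p → ℝ)) → ℝ}
    {W : (Fin m → Fin d → ℝ) × (Fin p → ℝ)} {M : ℝ}
    (h1 : ∀ r s, |fderiv ℝ F W (Pi.single r (Pi.single s 1), 0)| ^ (2 * k) ≤ M)
    (h2 : ∀ l, |fderiv ℝ F W (0, Pi.single l 1)| ^ (2 * k) ≤ M) :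
    gradWnorm k F W ≤ (((m * d + p : ℕ) : ℝ) * M) ^ ((2 * k : ℝ))⁻¹ := by
  unfold gradWnorm
  gcongr
  calc _ ≤ (∑ _r : Fin m, ∑ _s : Fin d, M) + ∑ _l : Fin p, M :=
        add_le_add (Finset.sum_le_sum fun r _ => Finset.sum_le_sum fun s _ => h1 r s)
          (Finset.sum_le_sum fun l _ => h2 l)
    _ = ((m * d + p : ℕ) : ℝ) * M := by
        simp only [Finset.sum_const, Finset.card_univ, Fintype.card_fin, nsmul_eq_mul]
        push_cast
        ring

lemma stability_moment_rpow_le {k B : ℕ} (hk : 1 ≤ k) (hB : 1 ≤ B) {η a : ℝ} (hη : 0 < η)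
    (ha : 0 ≤ a) :
    (a * (2 ^ k * (B : ℝ) ^ (k - 1) / η ^ k)) ^ ((2 * k : ℝ))⁻¹
      ≤ (2 * a / B) ^ ((2 * k : ℝ))⁻¹ * Real.sqrt (2 * B / η) := by
  have hB' : (0 : ℝ) < B := by exact_mod_cast hB
  refine le_of_pow_le_pow_left₀ (n := 2 * k) (by omega) (by positivity) ?_
  rw [mul_pow, rpow_two_mul_inv_pow hk (by positivity), rpow_two_mul_inv_pow hk (by positivity),
    pow_mul (Real.sqrt _), Real.sq_sqrt (by positivity)]
  obtain ⟨j, rfl⟩ := Nat.exists_eq_add_of_le' hk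
  have h : 2 * a / B * (2 * B / η) ^ (j + 1)
      = 2 * (a * (2 ^ (j + 1) * (B : ℝ) ^ (j + 1 - 1) / η ^ (j + 1))) := by
    rw [Nat.add_sub_cancel, div_pow, mul_pow, pow_succ (B : ℝ)]
    field_simp
  rw [h]
  have : 0 ≤ a * (2 ^ (j + 1) * (B : ℝ) ^ (j + 1 - 1) / η ^ (j + 1)) := by positivity
  linarith

/-- on the `δ`-neighborhood `X_δ = ∪ᵢ B(xᵢ, δ)` of the training data, the
input gradient of the model at a stable interpolation solution satisfies
`‖∇_x f(x, W*)‖_{2k} ≤ (C ‖(W₁*)ᵀ‖_{2k}/minᵢ‖xᵢ‖_{2k}) ((2nw/B)^{1/(2k)} √(2B/η) + 1)`. -/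
theorem max_grad_bound_on_neighborhood
    {m d p n : ℕ} (hn : 0 < n) (B k : ℕ) (hk : 1 ≤ k) (hB : 1 ≤ B)
    (η : ℝ) (hη : 0 < η)
    (C δa δ : ℝ) (hC : 0 < C) (hδa : 0 < δa)
    (ft : (Fin m → ℝ) → (Fin p → ℝ) → ℝ)
    (hft : Differentiable ℝ (fun q : (Fin m → ℝ) × (Fin p → ℝ) => ft q.1 q.2))
    (x : Fin n → Fin d → ℝ) (hx : ∀ i, x i ≠ 0) (y : Fin n → ℝ)
    (Wstar : (Fin m → Fin d → ℝ) × (Fin p → ℝ))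
    (hinterp : ∀ i, ft (mVec Wstar.1 (x i)) Wstar.2 = y i)
    (hmom1 : ∀ (r : Fin m) (s : Fin d),
      (1 / (n : ℝ)) * ∑ i,
          (fderiv ℝ (fun V : (Fin m → Fin d → ℝ) × (Fin p → ℝ) => ft (mVec V.1 (x i)) V.2)
            Wstar (Pi.single r (Pi.single s 1), 0)) ^ (2 * k)
        ≤ 2 ^ k * (B : ℝ) ^ (k - 1) / η ^ k)
    (hmom2 : ∀ l : Fin p,
      (1 / (n : ℝ)) * ∑ i,
          (fderiv ℝ (fun V : (Fin m → Fin d → ℝ) × (Fin p → ℝ) => ft (mVec V.1 (x i)) V.2)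
            Wstar (0, Pi.single l 1)) ^ (2 * k)
        ≤ 2 ^ k * (B : ℝ) ^ (k - 1) / η ^ k)
    (hsmooth : ∀ i, ∀ W' : (Fin m → Fin d → ℝ) × (Fin p → ℝ), paramDist W' Wstar ≤ δa →
      gradWnorm k (fun V => ft (mVec V.1 (x i)) V.2) W'
        ≤ C * (gradWnorm k (fun V => ft (mVec V.1 (x i)) V.2) Wstar + 1))
    (hδsmall : ∀ i, δ ≤ δa * l2norm (x i) / opNorm2 Wstar.1)
    (z : Fin d → ℝ) (hz : ∃ i, l2norm (fun t => z t - x i t) ≤ δ) :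
    lpnorm k (fun j => fderiv ℝ (fun u => ft (mVec Wstar.1 u) Wstar.2) z (Pi.single j 1))
      ≤ C * opNormP k (fun s r => Wstar.1 r s) /
          (Finset.univ.inf' ⟨⟨0, hn⟩, Finset.mem_univ _⟩ fun i => lpnorm k (x i)) *
        ((2 * (n : ℝ) * ((m * d + p : ℕ) : ℝ) / (B : ℝ)) ^ ((2 * k : ℝ))⁻¹ *
            Real.sqrt (2 * (B : ℝ) / η) + 1) := by
  obtain ⟨i, hi⟩ := hz
  have hk0 := lpnorm_pos hk (hx i)
  have hx2 : 0 < l2norm (x i) := l2norm_eq_lpnorm (x i) ▸ lpnorm_pos le_rfl (hx i)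
  set S := (2 * (n : ℝ) * ((m * d + p : ℕ) : ℝ) / (B : ℝ)) ^ ((2 * k : ℝ))⁻¹ *
    Real.sqrt (2 * (B : ℝ) / η) with hS
  set μ := Finset.univ.inf' ⟨⟨0, hn⟩, Finset.mem_univ _⟩ fun i => lpnorm k (x i)
  have hS0 : 0 ≤ S := by positivity
  have hμ : 0 < μ := (Finset.lt_inf'_iff _).mpr fun j _ => lpnorm_pos hk (hx j)
  have hμi : μ ≤ lpnorm k (x i) := Finset.inf'_le _ (Finset.mem_univ i)
  have hgrad : gradWnorm k (fun V => ft (mVec V.1 (x i)) V.2) Wstar ≤ S := by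
    refine (gradWnorm_le_of_pow_le
      (fun r s => pow_le_of_mean_pow_le _ (hmom1 r s) i)
      (fun l => pow_le_of_mean_pow_le _ (hmom2 l) i)).trans ?_
    have h := stability_moment_rpow_le (a := n * ((m * d + p : ℕ) : ℝ)) hk hB hη (by positivity)
    rw [← mul_assoc] at h
    rwa [← mul_assoc, mul_comm ((m * d + p : ℕ) : ℝ)]
  have hhidden : lpnorm k (hiddenGrad ft (mVec Wstar.1 z) Wstar.2) * lpnorm k (x i)
      ≤ C * (S + 1) := by
    have h := lpnorm_hiddenGrad_mul_le_gradWnorm hft hk (x i)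
      (rankOneShift Wstar.1 (x i) z, Wstar.2)
    rw [mVec_rankOneShift _ hx2] at h
    refine (h.trans (hsmooth i _
      (paramDist_rankOneShift_le _ _ hx2 hδa.le hi (hδsmall i)))).trans ?_
    gcongr
  rw [fderiv_input_single hft]
  calc _ ≤ opNormP k (fun s r => Wstar.1 r s)
          * lpnorm k (hiddenGrad ft (mVec Wstar.1 z) Wstar.2) := lpnorm_mVec_le hk _ _
    _ ≤ opNormP k (fun s r => Wstar.1 r s) * (C * (S + 1) / μ) := by
        refine mul_le_mul_of_nonneg_left ?_ (opNormP_nonneg _)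
        rw [le_div_iff₀ hμ]
        exact (mul_le_mul_of_nonneg_left hμi (lpnorm_nonneg _)).trans hhidden
    _ = _ := by ring
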